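/- Let A be a finite-dimensional K-algebra, E a basic generating A-module, Γ = End_A(E)^op, Q = D E, and let B be the generator-cotilted algebra of E with special idempotent e and corresponding intermediate extension functor c : mod A → mod B. Then c(E) ≅ D C^Q and c(A) ≅ Be. In particular c(A) is a projective B-module. -/

import Mathlib

/- Preliminary notions: `add`, `gen`, `cogen`, generators and cogenerators,
short exact sequences, basic modules, indecomposability. -/

noncomputable section

namespace GenFinitePaper

open Function

variable (R : Type) [Ring R]

/-- `M` lies in `add X`, i.e. `M` is a direct summand of a finite direct sum of copies of `X`. -/
def InAdd (X : Type) [AddCommGroup X] [Module R X]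
    (M : Type) [AddCommGroup M] [Module R M] : Prop :=
  ∃ (n : ℕ) (i : M →ₗ[R] (Fin n → X)) (p : (Fin n → X) →ₗ[R] M), p.comp i = LinearMap.id

/-- `M` lies in `gen X`, i.e. `M` is an epimorphic image of a module in `add X`. -/
def InGen (X : Type) [AddCommGroup X] [Module R X]
    (M : Type) [AddCommGroup M] [Module R M] : Prop :=
  ∃ (n : ℕ) (p : (Fin n → X) →ₗ[R] M), Surjective p

/-- `M` lies in `cogen X`, i.e. `M` embeds into a module in `add X`. -/
def InCogen (X : Type) [AddCommGroup X] [Module R X]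
    (M : Type) [AddCommGroup M] [Module R M] : Prop :=
  ∃ (n : ℕ) (i : M →ₗ[R] (Fin n → X)), Injective i

/-- `E` is a generator for `mod R`: `R ∈ add E`. -/
def IsGenerator (E : Type) [AddCommGroup E] [Module R E] : Prop :=
  InAdd R E R

/-- `E` is a cogenerator for `mod R`: every finitely generated (equivalently, over a
finite-dimensional algebra, finite-dimensional) module embeds into a module in `add E`. -/
def IsCogenerator (E : Type) [AddCommGroup E] [Module R E] : Prop :=
  ∀ (M : Type) [AddCommGroup M] [Module R M], Module.Finite R M → InCogen R E M

/-- A short exact sequence `0 → X → Y → Z → 0` of modules, given by a pair of composable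
linear maps. -/
def IsShortExact {X Y Z : Type} [AddCommGroup X] [Module R X] [AddCommGroup Y] [Module R Y]
    [AddCommGroup Z] [Module R Z] (f : X →ₗ[R] Y) (g : Y →ₗ[R] Z) : Prop :=
  Injective f ∧ Surjective g ∧ Exact f g

/-- A module is basic if it has no repeated indecomposable direct summands; equivalently
(by Krull--Remak--Schmidt) no nonzero module `X` is such that `X ⊕ X` is a direct summand. -/
def IsBasic (M : Type) [AddCommGroup M] [Module R M] : Prop :=
  ∀ (X Y : Type) [AddCommGroup X] [Module R X] [AddCommGroup Y] [Module R Y],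
    Nonempty (M ≃ₗ[R] ((X × X) × Y)) → Subsingleton X

/-- A module is indecomposable if it is nonzero and admits no nontrivial idempotent
endomorphism. -/
def Indecomposable (M : Type) [AddCommGroup M] [Module R M] : Prop :=
  Nontrivial M ∧ ∀ φ : M →ₗ[R] M, φ.comp φ = φ → φ = 0 ∨ φ = LinearMap.id

end GenFinitePaper
/- K-linear duality: the dual of the regular module, duals of modules over endomorphism
rings, and Hom-modules over endomorphism rings. -/

namespace GenFinitePaper

open Function

variable (K : Type) [Field K]

/-- `D R = Hom_K(R, K)`, the `K`-linear dual of a `K`-algebra `R`, viewed as a left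
`R`-module via `(r • f) x = f (x * r)`. -/
def RegularDual (R : Type) [Ring R] [Algebra K R] : Type := R →ₗ[K] K

namespace RegularDual

variable (R : Type) [Ring R] [Algebra K R]

instance : AddCommGroup (RegularDual K R) := inferInstanceAs (AddCommGroup (R →ₗ[K] K))

instance : Module K (RegularDual K R) := inferInstanceAs (Module K (R →ₗ[K] K))

/-- The action of `R` on its `K`-linear dual, by `(r • f) x = f (x * r)`. -/
def actHom : R →+* Module.End K (R →ₗ[K] K) where
  toFun r := (LinearMap.mulRight K r).lcomp K K
  map_one' := by ext f x; simp
  map_mul' r s := by ext f x; simp [mul_assoc]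
  map_zero' := by ext f x; simp
  map_add' r s := by ext f x; simp [mul_add]

instance : Module R (RegularDual K R) :=
  Module.compHom (R →ₗ[K] K) (actHom K R)

lemma smul_def (r : R) (f : RegularDual K R) :
    r • f = (f : R →ₗ[K] K).comp (LinearMap.mulRight K r) := rfl

end RegularDual

/-- `D M = Hom_K(M, K)`, the `K`-linear dual of a module `M` over a `K`-algebra `R`,
viewed as a left module over `End_R(M)ᵒᵖ` via `(φᵒᵖ • f) = f ∘ φ`. -/
def ModuleDual (R : Type) [Ring R] [Algebra K R] (M : Type) [AddCommGroup M] [Module R M]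
    [Module K M] [IsScalarTower K R M] : Type := M →ₗ[K] K

namespace ModuleDual

variable (R : Type) [Ring R] [Algebra K R] (M : Type) [AddCommGroup M] [Module R M]
  [Module K M] [IsScalarTower K R M]

instance : AddCommGroup (ModuleDual K R M) := inferInstanceAs (AddCommGroup (M →ₗ[K] K))

instance : Module K (ModuleDual K R M) := inferInstanceAs (Module K (M →ₗ[K] K))

/-- The action of `End_R(M)ᵒᵖ` on `Hom_K(M, K)` by precomposition. -/
def actHom : (Module.End R M)ᵐᵒᵖ →+* Module.End K (M →ₗ[K] K) where
  toFun φ := (LinearMap.restrictScalars K φ.unop).lcomp K K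
  map_one' := by ext f x; rfl
  map_mul' φ ψ := by ext f x; rfl
  map_zero' := by ext f x; simp
  map_add' φ ψ := by ext f x; simp

instance : Module (Module.End R M)ᵐᵒᵖ (ModuleDual K R M) :=
  Module.compHom (M →ₗ[K] K) (actHom K R M)

lemma smul_def (φ : (Module.End R M)ᵐᵒᵖ) (f : ModuleDual K R M) :
    φ • f = (f : M →ₗ[K] K).comp (LinearMap.restrictScalars K φ.unop) := rfl

end ModuleDual

/-- `Hom_R(E, N)` viewed as a left module over `Γ = End_R(E)ᵒᵖ` via `(φᵒᵖ • g) = g ∘ φ`. -/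
def HomOp (R : Type) [Ring R] (E : Type) [AddCommGroup E] [Module R E]
    (N : Type) [AddCommGroup N] [Module R N] : Type := E →ₗ[R] N

namespace HomOp

variable (R : Type) [Ring R] (E : Type) [AddCommGroup E] [Module R E]
  (N : Type) [AddCommGroup N] [Module R N]

instance : AddCommGroup (HomOp R E N) := inferInstanceAs (AddCommGroup (E →ₗ[R] N))

/-- The action of `End_R(E)ᵒᵖ` on `Hom_R(E, N)` by precomposition. -/
def actHom : (Module.End R E)ᵐᵒᵖ →+* Module.End ℤ (E →ₗ[R] N) where
  toFun φ :=
    { toFun := fun g => (g : E →ₗ[R] N).comp φ.unop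
      map_add' := fun g h => LinearMap.add_comp _ _ _
      map_smul' := fun n g => LinearMap.smul_comp n g φ.unop }
  map_one' := by ext g x; rfl
  map_mul' φ ψ := by ext g x; rfl
  map_zero' := by ext g x; simp
  map_add' φ ψ := by ext g x; simp

instance : Module (Module.End R E)ᵐᵒᵖ (HomOp R E N) :=
  Module.compHom (E →ₗ[R] N) (actHom R E N)

lemma smul_def (φ : (Module.End R E)ᵐᵒᵖ) (g : HomOp R E N) :
    φ • g = (g : E →ₗ[R] N).comp φ.unop := rfl

end HomOp

end GenFinitePaper

namespace GenFinitePaper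

/-- Unfold a `RegularDual` element to a linear map. -/
def RegularDual.toLin (K : Type) [Field K] (R : Type) [Ring R] [Algebra K R]
    (f : RegularDual K R) : R →ₗ[K] K := f

/-- Unfold a `ModuleDual` element to a linear map. -/
def ModuleDual.toLin (K : Type) [Field K] (R : Type) [Ring R] [Algebra K R]
    (M : Type) [AddCommGroup M] [Module R M] [Module K M] [IsScalarTower K R M]
    (f : ModuleDual K R M) : M →ₗ[K] K := f

/-- Unfold a `HomOp` element to a linear map. -/
def HomOp.toLin (R : Type) [Ring R] (E : Type) [AddCommGroup E] [Module R E]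
    (N : Type) [AddCommGroup N] [Module R N] (g : HomOp R E N) : E →ₗ[R] N := g

end GenFinitePaper
/- Tilting and cotilting modules, and special (co)tilting modules. -/

namespace GenFinitePaper

open Function

variable (Γ : Type) [Ring Γ]

/-- A (classical) tilting module:
(T1) projective dimension at most 1;
(T2) no self-extensions (every short exact sequence `0 → T → X → T → 0` splits);
(T3) an exact sequence `0 → Γ → T₀ → T₁ → 0` with `T₀, T₁ ∈ add T`. -/
structure IsTilting (T : Type) [AddCommGroup T] [Module Γ T] : Prop where
  pdim_le_one : ∃ (P₁ P₀ : Type) (_ : AddCommGroup P₁) (_ : Module Γ P₁)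
      (_ : AddCommGroup P₀) (_ : Module Γ P₀) (f : P₁ →ₗ[Γ] P₀) (g : P₀ →ₗ[Γ] T),
      Module.Projective Γ P₁ ∧ Module.Projective Γ P₀ ∧ IsShortExact Γ f g
  rigid : ∀ (X : Type) [AddCommGroup X] [Module Γ X], ∀ (f : T →ₗ[Γ] X) (g : X →ₗ[Γ] T),
      IsShortExact Γ f g → ∃ r : X →ₗ[Γ] T, r.comp f = LinearMap.id
  coresolves : ∃ (T₀ T₁ : Type) (_ : AddCommGroup T₀) (_ : Module Γ T₀)
      (_ : AddCommGroup T₁) (_ : Module Γ T₁) (f : Γ →ₗ[Γ] T₀) (g : T₀ →ₗ[Γ] T₁),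
      InAdd Γ T T₀ ∧ InAdd Γ T T₁ ∧ IsShortExact Γ f g

/-- A `P`-special tilting module, for `P` a projective module: a tilting module `T` with
`P ∈ add T` such that the module `T₀` in (T3) can be chosen in `add P`. -/
structure IsSpecialTilting (P : Type) [AddCommGroup P] [Module Γ P]
    (T : Type) [AddCommGroup T] [Module Γ T] : Prop where
  isTilting : IsTilting Γ T
  mem_add : InAdd Γ T P
  coresolves_special : ∃ (T₀ T₁ : Type) (_ : AddCommGroup T₀) (_ : Module Γ T₀)
      (_ : AddCommGroup T₁) (_ : Module Γ T₁) (f : Γ →ₗ[Γ] T₀) (g : T₀ →ₗ[Γ] T₁),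
      InAdd Γ P T₀ ∧ InAdd Γ T T₁ ∧ IsShortExact Γ f g

variable (K : Type) [Field K] [Algebra K Γ]

/-- A (classical) cotilting module:
(C1) injective dimension at most 1;
(C2) no self-extensions;
(C3) an exact sequence `0 → C1 → C0 → DΓ → 0` with `C0, C1 ∈ add C`,
where `DΓ` is the `K`-linear dual of the regular module. -/
structure IsCotilting (C : Type) [AddCommGroup C] [Module Γ C] : Prop where
  idim_le_one : ∃ (I0 I1 : Type) (_ : AddCommGroup I0) (_ : Module Γ I0)
      (_ : AddCommGroup I1) (_ : Module Γ I1) (f : C →ₗ[Γ] I0) (g : I0 →ₗ[Γ] I1),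
      Module.Injective Γ I0 ∧ Module.Injective Γ I1 ∧ IsShortExact Γ f g
  rigid : ∀ (X : Type) [AddCommGroup X] [Module Γ X], ∀ (f : C →ₗ[Γ] X) (g : X →ₗ[Γ] C),
      IsShortExact Γ f g → ∃ r : X →ₗ[Γ] C, r.comp f = LinearMap.id
  resolves : ∃ (C1 C0 : Type) (_ : AddCommGroup C1) (_ : Module Γ C1)
      (_ : AddCommGroup C0) (_ : Module Γ C0) (f : C1 →ₗ[Γ] C0)
      (g : C0 →ₗ[Γ] RegularDual K Γ),
      InAdd Γ C C1 ∧ InAdd Γ C C0 ∧ IsShortExact Γ f g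

/-- A `Q`-special cotilting module, for `Q` an injective module: a cotilting module `C` with
`Q ∈ add C` such that the module `C0` in (C3) can be chosen in `add Q`. -/
structure IsSpecialCotilting (Q : Type) [AddCommGroup Q] [Module Γ Q]
    (C : Type) [AddCommGroup C] [Module Γ C] : Prop where
  isCotilting : IsCotilting Γ K C
  mem_add : InAdd Γ C Q
  resolves_special : ∃ (C1 C0 : Type) (_ : AddCommGroup C1) (_ : Module Γ C1)
      (_ : AddCommGroup C0) (_ : Module Γ C0) (f : C1 →ₗ[Γ] C0)
      (g : C0 →ₗ[Γ] RegularDual K Γ),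
      InAdd Γ Q C0 ∧ InAdd Γ C C1 ∧ IsShortExact Γ f g

end GenFinitePaper
/- Idempotent corners, stable and costable modules, and the intermediate extension functor
associated to an idempotent, characterised on objects. -/

namespace GenFinitePaper

open Function

variable (A B : Type) [Ring A] [Ring B]

/-- An identification of a ring `A` with the corner `eBe` of a ring `B` at an idempotent
`e` (the data of the multiplicative, additive map `A → B` landing in the corner). -/
structure CornerMap (e : B) where
  toHom : A →+ B
  map_mul : ∀ a b : A, toHom (a * b) = toHom a * toHom b
  map_one : toHom 1 = e
  mem_left : ∀ a : A, e * toHom a = toHom a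
  mem_right : ∀ a : A, toHom a * e = toHom a

/-- A full corner identification: additionally bijective onto `eBe`. -/
structure CornerIso (e : B) extends CornerMap A B e where
  inj : Function.Injective toHom
  surj : ∀ b : B, e * b = b → b * e = b → ∃ a : A, toHom a = b

variable {A B}

/-- The subgroup `eY` of a `B`-module `Y`, which is a module over `A ≅ eBe`. -/
def ePart {e : B} (φ : CornerMap A B e) (Y : Type) [AddCommGroup Y] [Module B Y] : Type :=
  {y : Y // e • y = y}

namespace ePart

variable {e : B} (φ : CornerMap A B e) (Y : Type) [AddCommGroup Y] [Module B Y]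

/-- The underlying element of `Y`. -/
def val (y : ePart φ Y) : Y := Subtype.val y

lemma prop (y : ePart φ Y) : e • y.val = y.val := Subtype.property y

/-- The `e`-part of a module, as an additive subgroup. -/
def addSubgroup : AddSubgroup Y where
  carrier := {y | e • y = y}
  add_mem' := fun {a b} ha hb => by
    simp only [Set.mem_setOf_eq] at *
    rw [smul_add, ha, hb]
  zero_mem' := smul_zero e
  neg_mem' := fun {a} ha => by
    simp only [Set.mem_setOf_eq] at *
    rw [smul_neg, ha]

instance : AddCommGroup (ePart φ Y) :=
  inferInstanceAs (AddCommGroup (addSubgroup (e := e) Y))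

/-- The action of `A ≅ eBe` on `eY`. -/
def actHom : A →+* Module.End ℤ (ePart φ Y) where
  toFun a :=
    { toFun := fun y => ⟨φ.toHom a • y.val, by rw [← mul_smul, φ.mem_left]⟩
      map_add' := fun y z => Subtype.ext (smul_add (φ.toHom a) y.val z.val)
      map_smul' := fun n y => Subtype.ext (by
        show φ.toHom a • (n • y).val = n • (φ.toHom a • y.val)
        have : (n • y).val = n • y.val := rfl
        rw [this, smul_comm]) }
  map_one' := by
    refine LinearMap.ext fun y => Subtype.ext ?_
    show φ.toHom 1 • y.val = y.val
    rw [φ.map_one]; exact y.prop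
  map_mul' a b := by
    refine LinearMap.ext fun y => Subtype.ext ?_
    show φ.toHom (a * b) • y.val = φ.toHom a • φ.toHom b • y.val
    rw [φ.map_mul, mul_smul]
  map_zero' := by
    refine LinearMap.ext fun y => Subtype.ext ?_
    show φ.toHom 0 • y.val = 0
    rw [map_zero, zero_smul]
  map_add' a b := by
    refine LinearMap.ext fun y => Subtype.ext ?_
    show φ.toHom (a + b) • y.val = φ.toHom a • y.val + φ.toHom b • y.val
    rw [map_add, add_smul]

instance : Module A (ePart φ Y) :=
  Module.compHom (ePart φ Y) (actHom φ Y)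

lemma smul_def (a : A) (y : ePart φ Y) : (a • y).val = φ.toHom a • y.val := rfl

end ePart

variable (B)

/-- A `B`-module is stable (lies in `cogen D(eB)`) if it has no nonzero submodule killed
by the idempotent `e`, i.e. `eBy ≠ 0` for `y ≠ 0`. -/
def IsStableMod (e : B) (Y : Type) [AddCommGroup Y] [Module B Y] : Prop :=
  ∀ y : Y, (∀ b : B, e • (b • y) = (0 : Y)) → y = 0

/-- A `B`-module is costable (lies in `gen Be`) if it is generated by `eY`:
`B • (e • Y) = Y`. -/
def IsCostableMod (e : B) (Y : Type) [AddCommGroup Y] [Module B Y] : Prop :=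
  (⊤ : Submodule B Y) ≤ Submodule.span B {z : Y | ∃ w : Y, z = e • w}

variable {B}

/-- `Y` is (isomorphic to) the intermediate extension `c(M)` of the `A`-module `M` along
the idempotent `e`: it is stable and costable (so lies in the image of the intermediate
extension functor), and `eY ≅ M` over `A ≅ eBe`.  This characterises `c(M)` uniquely up
to isomorphism. -/
def IsIntermediateExtension {e : B} (φ : CornerMap A B e)
    (M : Type) [AddCommGroup M] [Module A M]
    (Y : Type) [AddCommGroup Y] [Module B Y] : Prop :=
  IsCostableMod B e Y ∧ IsStableMod B e Y ∧ Nonempty (ePart φ Y ≃ₗ[A] M)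

variable (B)

/-- The left ideal `Be`, for `e` an idempotent of `B`. -/
def leftCornerIdeal (e : B) : Submodule B B where
  carrier := {b | b * e = b}
  add_mem' := fun {a b} ha hb => by
    simp only [Set.mem_setOf_eq] at *
    rw [add_mul, ha, hb]
  zero_mem' := zero_mul e
  smul_mem' := fun c {x} hx => by
    simp only [Set.mem_setOf_eq, smul_eq_mul] at *
    rw [mul_assoc, hx]

variable (K : Type) [Field K] [Algebra K B]

/-- The right ideal `eB`, for `e` an idempotent of `B`, as a `K`-subspace of `B`. -/
def rightCornerSubspace (e : B) : Submodule K B where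
  carrier := {b | e * b = b}
  add_mem' := fun {a b} ha hb => by
    simp only [Set.mem_setOf_eq] at *
    rw [mul_add, ha, hb]
  zero_mem' := mul_zero e
  smul_mem' := fun k {x} hx => by
    simp only [Set.mem_setOf_eq] at *
    rw [mul_smul_comm, hx]

/-- `D(eB) = Hom_K(eB, K)`, as a left `B`-module via `(c • f) x = f (x * c)`. -/
def CornerDual (e : B) : Type := rightCornerSubspace B K e →ₗ[K] K

namespace CornerDual

variable (e : B)

instance : AddCommGroup (CornerDual B K e) :=
  inferInstanceAs (AddCommGroup (rightCornerSubspace B K e →ₗ[K] K))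

instance : Module K (CornerDual B K e) :=
  inferInstanceAs (Module K (rightCornerSubspace B K e →ₗ[K] K))

/-- Right multiplication by `c : B` on the right ideal `eB`, as a `K`-linear map. -/
def rmul (c : B) : rightCornerSubspace B K e →ₗ[K] rightCornerSubspace B K e where
  toFun x := ⟨(x : B) * c, by
    have hx : e * (x : B) = (x : B) := x.2
    show e * ((x : B) * c) = (x : B) * c
    rw [← mul_assoc, hx]⟩
  map_add' x y := Subtype.ext (add_mul _ _ _)
  map_smul' k x := Subtype.ext (smul_mul_assoc k (x : B) c)

/-- The action of `B` on `D(eB)` by `(c • f) x = f (x * c)`. -/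
def actHom : B →+* Module.End K (rightCornerSubspace B K e →ₗ[K] K) where
  toFun c := (rmul B K e c).lcomp K K
  map_one' := by
    ext f x
    show f (rmul B K e 1 x) = f x
    congr 1
    exact Subtype.ext (mul_one _)
  map_mul' c d := by
    ext f x
    show f (rmul B K e (c * d) x) = f (rmul B K e d (rmul B K e c x))
    congr 1
    exact Subtype.ext (mul_assoc _ _ _).symm
  map_zero' := by
    ext f x
    show f (rmul B K e 0 x) = 0
    have h0 : rmul B K e 0 x = 0 := Subtype.ext (mul_zero _)
    rw [h0, map_zero]
  map_add' c d := by
    ext f x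
    show f (rmul B K e (c + d) x) = f (rmul B K e c x) + f (rmul B K e d x)
    have h : rmul B K e (c + d) x = rmul B K e c x + rmul B K e d x :=
      Subtype.ext (mul_add _ _ _)
    rw [h, map_add]

instance : Module B (CornerDual B K e) :=
  Module.compHom (rightCornerSubspace B K e →ₗ[K] K) (actHom B K e)

end CornerDual

end GenFinitePaper
/- The canonical corner identification of `A` with `e B e`, where `B` is the endomorphism
algebra of a module over `Γ = End_A(E)ᵒᵖ` having the dual `D E` as a direct summand, and
`e` is the idempotent given by projection onto that summand. -/

namespace GenFinitePaper

open Function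

section Canon

variable (K A : Type) [Field K] [Ring A] [Algebra K A]
variable (E : Type) [AddCommGroup E] [Module A E] [Module K E] [IsScalarTower K A E]

/-- The action of `a : A` on `E`, as a `K`-linear map. -/
def smulKLin (a : A) : E →ₗ[K] E where
  toFun x := a • x
  map_add' x y := smul_add a x y
  map_smul' k x := by
    simp only [RingHom.id_apply]
    rw [← algebraMap_smul A k x, ← mul_smul, ← Algebra.commutes k a, mul_smul,
      algebraMap_smul]

/-- The right action of `a : A` on `D E = Hom_K(E, K)` by precomposition, as an
endomorphism of the `Γ = End_A(E)ᵒᵖ`-module `D E`. -/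
def dualAct (a : A) :
    ModuleDual K A E →ₗ[(Module.End A E)ᵐᵒᵖ] ModuleDual K A E where
  toFun f := (ModuleDual.toLin K A E f).comp (smulKLin K A E a)
  map_add' f g := LinearMap.add_comp _ _ _
  map_smul' γ f := by
    simp only [RingHom.id_apply]
    refine LinearMap.ext fun x => ?_
    show ModuleDual.toLin K A E f (γ.unop (a • x)) = ModuleDual.toLin K A E f (a • γ.unop x)
    rw [map_smul]

lemma dualAct_one : dualAct K A E 1 = LinearMap.id := by
  refine LinearMap.ext fun f => ?_
  refine LinearMap.ext fun x => ?_
  show ModuleDual.toLin K A E f ((1 : A) • x) = ModuleDual.toLin K A E f x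
  rw [one_smul]

lemma dualAct_mul (a b : A) :
    (dualAct K A E b).comp (dualAct K A E a) = dualAct K A E (a * b) := by
  refine LinearMap.ext fun f => ?_
  refine LinearMap.ext fun x => ?_
  show ModuleDual.toLin K A E f (a • b • x) = ModuleDual.toLin K A E f ((a * b) • x)
  rw [mul_smul]

variable (T : Type) [AddCommGroup T] [Module (Module.End A E)ᵐᵒᵖ T]
variable (i₀ : ModuleDual K A E →ₗ[(Module.End A E)ᵐᵒᵖ] T)
variable (p₀ : T →ₗ[(Module.End A E)ᵐᵒᵖ] ModuleDual K A E)

/-- The canonical identification of `A` with the corner of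
`B = End_Γ(T)ᵒᵖ` at the idempotent `e` given by projection onto a direct summand
`D E` of `T`, sending `a` to the endomorphism acting by `a` on this summand. -/
def canonicalCornerMap (hsplit : p₀.comp i₀ = LinearMap.id) :
    CornerMap A (Module.End (Module.End A E)ᵐᵒᵖ T)ᵐᵒᵖ (MulOpposite.op (i₀.comp p₀)) where
  toHom :=
    { toFun := fun a => MulOpposite.op ((i₀.comp (dualAct K A E a)).comp p₀)
      map_zero' := by
        rw [← MulOpposite.op_zero]
        refine congrArg MulOpposite.op ?_
        refine LinearMap.ext fun t => ?_
        have h0 : dualAct K A E 0 (p₀ t) = 0 := by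
          refine LinearMap.ext fun x => ?_
          show ModuleDual.toLin K A E (p₀ t) ((0 : A) • x) = 0
          rw [zero_smul, map_zero]
        show i₀ (dualAct K A E 0 (p₀ t)) = 0
        rw [h0, map_zero]
      map_add' := fun a b => by
        rw [← MulOpposite.op_add]
        refine congrArg MulOpposite.op ?_
        refine LinearMap.ext fun t => ?_
        have h : dualAct K A E (a + b) (p₀ t) =
            dualAct K A E a (p₀ t) + dualAct K A E b (p₀ t) := by
          refine LinearMap.ext fun x => ?_
          show ModuleDual.toLin K A E (p₀ t) ((a + b) • x) =
            ModuleDual.toLin K A E (p₀ t) (a • x) + ModuleDual.toLin K A E (p₀ t) (b • x)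
          rw [add_smul, map_add]
        show i₀ (dualAct K A E (a + b) (p₀ t)) = i₀ (dualAct K A E a (p₀ t)) +
          i₀ (dualAct K A E b (p₀ t))
        rw [h, map_add] }
  map_mul := fun a b => by
    show MulOpposite.op _ = MulOpposite.op _ * MulOpposite.op _
    rw [← MulOpposite.op_mul]
    refine congrArg MulOpposite.op ?_
    have hsp : ∀ z, p₀ (i₀ z) = z := fun z => LinearMap.ext_iff.mp hsplit z
    refine LinearMap.ext fun t => ?_
    show i₀ (dualAct K A E (a * b) (p₀ t)) =
      i₀ (dualAct K A E b (p₀ (i₀ (dualAct K A E a (p₀ t)))))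
    rw [hsp, ← dualAct_mul]
    rfl
  map_one := by
    show MulOpposite.op _ = MulOpposite.op _
    refine congrArg MulOpposite.op ?_
    rw [dualAct_one]
    rfl
  mem_left := fun a => by
    show MulOpposite.op _ * MulOpposite.op _ = MulOpposite.op _
    rw [← MulOpposite.op_mul]
    refine congrArg MulOpposite.op ?_
    have hsp : ∀ z, p₀ (i₀ z) = z := fun z => LinearMap.ext_iff.mp hsplit z
    refine LinearMap.ext fun t => ?_
    show i₀ (dualAct K A E a (p₀ (i₀ (p₀ t)))) = i₀ (dualAct K A E a (p₀ t))
    rw [hsp]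
  mem_right := fun a => by
    show MulOpposite.op _ * MulOpposite.op _ = MulOpposite.op _
    rw [← MulOpposite.op_mul]
    refine congrArg MulOpposite.op ?_
    have hsp : ∀ z, p₀ (i₀ z) = z := fun z => LinearMap.ext_iff.mp hsplit z
    refine LinearMap.ext fun t => ?_
    show i₀ (p₀ (i₀ (dualAct K A E a (p₀ t)))) = i₀ (dualAct K A E a (p₀ t))
    rw [hsp]

end Canon

end GenFinitePaper

namespace GenFinitePaper

open Function

section General

variable {Γ : Type} [Ring Γ]

/-- If `C` has no self-extensions, then every extension of `C` by a module in `add C` splits. -/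
lemma exists_retraction_of_rigid {C C₁ X : Type} [AddCommGroup C] [Module Γ C]
    [AddCommGroup C₁] [Module Γ C₁] [AddCommGroup X] [Module Γ X]
    (hC : ∀ (X : Type) [AddCommGroup X] [Module Γ X], ∀ (f : C →ₗ[Γ] X) (g : X →ₗ[Γ] C),
      IsShortExact Γ f g → ∃ r : X →ₗ[Γ] C, r.comp f = LinearMap.id)
    (hC₁ : InAdd Γ C C₁) (f : C₁ →ₗ[Γ] X) (g : X →ₗ[Γ] C) (hfg : IsShortExact Γ f g) :
    ∃ r : X →ₗ[Γ] C₁, r.comp f = LinearMap.id := by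
  obtain ⟨n, i, p, hpi⟩ := hC₁
  obtain ⟨hf, hg, hex⟩ := hfg
  have key : ∀ j : C₁ →ₗ[Γ] C, ∃ r : X →ₗ[Γ] C, r.comp f = j := by
    intro j
    let N : Submodule Γ (C × X) := LinearMap.range (j.prod (-f))
    have hN : N ≤ LinearMap.ker (g.comp (LinearMap.snd Γ C X)) := by
      rintro _ ⟨a, rfl⟩
      simp [hex.apply_apply_eq_zero a]
    have hex' : IsShortExact Γ (N.mkQ.comp (LinearMap.inl Γ C X))
        (N.liftQ (g.comp (LinearMap.snd Γ C X)) hN) := by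
      refine ⟨?_, ?_, ?_⟩
      · rw [← LinearMap.ker_eq_bot, LinearMap.ker_eq_bot']
        intro c hc
        obtain ⟨a, ha⟩ := (Submodule.Quotient.mk_eq_zero N).1 hc
        obtain ⟨h1, h2⟩ := Prod.ext_iff.1 ha
        have h3 : a = 0 := hf (by simpa using h2)
        simpa [h3] using h1.symm
      · intro c
        obtain ⟨x, rfl⟩ := hg c
        exact ⟨N.mkQ (0, x), rfl⟩
      · intro y
        obtain ⟨⟨c, x⟩, rfl⟩ := N.mkQ_surjective y
        constructor
        · intro hx
          obtain ⟨a, rfl⟩ := (hex x).1 hx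
          refine ⟨c + j a, ?_⟩
          rw [← sub_eq_zero, LinearMap.comp_apply, ← map_sub]
          refine (Submodule.Quotient.mk_eq_zero N).2 ⟨a, ?_⟩
          simp
        · rintro ⟨c', hc'⟩
          rw [← hc']
          exact map_zero g
    obtain ⟨r, hr⟩ := hC _ _ _ hex'
    refine ⟨r.comp (N.mkQ.comp (LinearMap.inr Γ C X)), LinearMap.ext fun a => ?_⟩
    have h1 : N.mkQ (0, f a) = N.mkQ (j a, 0) := by
      rw [← sub_eq_zero, ← map_sub]
      refine (Submodule.Quotient.mk_eq_zero N).2 ⟨-a, ?_⟩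
      simp
    change r (N.mkQ (0, f a)) = j a
    rw [h1]
    exact LinearMap.congr_fun hr (j a)
  choose r hr using fun k : Fin n => key ((LinearMap.proj k).comp i)
  refine ⟨p.comp (LinearMap.pi r), LinearMap.ext fun a => ?_⟩
  have h1 : LinearMap.pi r (f a) = i a := funext fun k => LinearMap.congr_fun (hr k) a
  change p (LinearMap.pi r (f a)) = a
  rw [h1]
  exact LinearMap.congr_fun hpi a

/-- If `C` has no self-extensions, then maps from `C` lift along epimorphisms with kernel
in `add C`. -/
lemma exists_lift_of_rigid {C C₁ X Z : Type} [AddCommGroup C] [Module Γ C]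
    [AddCommGroup C₁] [Module Γ C₁] [AddCommGroup X] [Module Γ X] [AddCommGroup Z] [Module Γ Z]
    (hC : ∀ (X : Type) [AddCommGroup X] [Module Γ X], ∀ (f : C →ₗ[Γ] X) (g : X →ₗ[Γ] C),
      IsShortExact Γ f g → ∃ r : X →ₗ[Γ] C, r.comp f = LinearMap.id)
    (hC₁ : InAdd Γ C C₁) (f : C₁ →ₗ[Γ] X) (g : X →ₗ[Γ] Z) (hfg : IsShortExact Γ f g)
    (u : C →ₗ[Γ] Z) : ∃ v : C →ₗ[Γ] X, g.comp v = u := by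
  obtain ⟨hf, hg, hex⟩ := hfg
  let W : Submodule Γ (X × C) :=
    LinearMap.eqLocus (g.comp (LinearMap.fst Γ X C)) (u.comp (LinearMap.snd Γ X C))
  have hW : ∀ w : W, g w.1.1 = u w.1.2 := fun w => w.2
  let f' : C₁ →ₗ[Γ] W := (f.prod 0).codRestrict W fun a => by
    change g (f a) = u 0
    rw [hex.apply_apply_eq_zero, map_zero]
  let g' : W →ₗ[Γ] C := (LinearMap.snd Γ X C).comp W.subtype
  have hg' : Surjective g' := fun c => by
    obtain ⟨x, hx⟩ := hg (u c)
    exact ⟨⟨(x, c), hx⟩, rfl⟩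
  have hker : ∀ w : W, g' w = 0 → ∃ a, f' a = w := fun w hw => by
    have hw' : w.1.2 = 0 := hw
    obtain ⟨a, ha⟩ := (hex w.1.1).1 (by rw [hW, hw', map_zero])
    exact ⟨a, Subtype.ext (Prod.ext ha hw'.symm)⟩
  obtain ⟨r, hr⟩ := exists_retraction_of_rigid hC hC₁ f' g' ⟨fun a b hab => hf
    (congrArg (fun w : W => w.1.1) hab), hg', fun w => ⟨hker w, by rintro ⟨a, rfl⟩; rfl⟩⟩
  have hrf : ∀ a, r (f' a) = a := fun a => LinearMap.congr_fun hr a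
  let t : W →ₗ[Γ] W := LinearMap.id - f'.comp r
  have ht : LinearMap.ker g' ≤ LinearMap.ker t := by
    intro w hw
    obtain ⟨a, rfl⟩ := hker w hw
    change f' a - f' (r (f' a)) = 0
    rw [hrf, sub_self]
  let s : C →ₗ[Γ] W := ((LinearMap.ker g').liftQ t ht).comp
    (g'.quotKerEquivOfSurjective hg').symm.toLinearMap
  have hs : ∀ w, s (g' w) = t w := by
    intro w
    have h1 : (g'.quotKerEquivOfSurjective hg').symm (g' w) = (LinearMap.ker g').mkQ w := by
      rw [LinearEquiv.symm_apply_eq]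
      rfl
    change (LinearMap.ker g').liftQ t ht ((g'.quotKerEquivOfSurjective hg').symm (g' w)) = t w
    rw [h1]
    rfl
  refine ⟨((LinearMap.fst Γ X C).comp W.subtype).comp s, LinearMap.ext fun c => ?_⟩
  obtain ⟨w, rfl⟩ := hg' c
  change g (s (g' w)).1.1 = u (g' w)
  rw [hs, hW]
  change u (w.1.2 - 0) = u w.1.2
  rw [sub_zero]

end General

section RegularDual

variable {K : Type} [Field K] {Γ : Type} [Ring Γ] [Algebra K Γ]

instance RegularDual.isScalarTower : IsScalarTower K Γ (RegularDual K Γ) where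
  smul_assoc k γ f := LinearMap.ext fun x => by
    change RegularDual.toLin K Γ f (x * (k • γ)) = k • RegularDual.toLin K Γ f (x * γ)
    rw [mul_smul_comm, map_smul]

instance RegularDual.finiteDimensional [FiniteDimensional K Γ] :
    FiniteDimensional K (RegularDual K Γ) :=
  inferInstanceAs (FiniteDimensional K (Γ →ₗ[K] K))

section

variable {X : Type} [AddCommGroup X] [Module Γ X] [Module K X] [IsScalarTower K Γ X]

/-- The `Γ`-linear map `X → DΓ` corresponding to a `K`-linear form on `X`. -/
def toRegularDual (f : X →ₗ[K] K) : X →ₗ[Γ] RegularDual K Γ where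
  toFun x := f.comp ((LinearMap.toSpanSingleton Γ X x).restrictScalars K)
  map_add' x y := LinearMap.ext fun γ => by
    change f (γ • (x + y)) = f (γ • x) + f (γ • y)
    rw [smul_add, map_add]
  map_smul' r x := LinearMap.ext fun γ => by
    change f (γ • r • x) = f ((γ * r) • x)
    rw [mul_smul]

lemma toRegularDual_apply (f : X →ₗ[K] K) (x : X) (γ : Γ) :
    RegularDual.toLin K Γ (toRegularDual f x) γ = f (γ • x) := rfl

/-- Evaluation at an element of `Γ`, as a linear form on `DΓ`. -/
def RegularDual.eval (γ : Γ) : RegularDual K Γ →ₗ[K] K where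
  toFun f := RegularDual.toLin K Γ f γ
  map_add' _ _ := rfl
  map_smul' _ _ := rfl

lemma toRegularDual_eval_one (u : X →ₗ[Γ] RegularDual K Γ) :
    toRegularDual ((RegularDual.eval (1 : Γ)).comp (u.restrictScalars K)) = u := by
  refine LinearMap.ext fun x => LinearMap.ext fun γ => ?_
  change RegularDual.toLin K Γ (u (γ • x)) 1 = RegularDual.toLin K Γ (u x) γ
  rw [map_smul]
  change RegularDual.toLin K Γ (u x) (1 * γ) = _
  rw [one_mul]

end

/-- Finite powers of `DΓ` are injective. -/
lemma exists_extension_regularDual {X Y : Type} [AddCommGroup X] [Module Γ X]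
    [AddCommGroup Y] [Module Γ Y] {ι : Type} (f : X →ₗ[Γ] Y) (hf : Injective f)
    (g : X →ₗ[Γ] ι → RegularDual K Γ) : ∃ h : Y →ₗ[Γ] ι → RegularDual K Γ, h.comp f = g := by
  let _ : Module K X := Module.compHom X (algebraMap K Γ)
  let _ : Module K Y := Module.compHom Y (algebraMap K Γ)
  have : IsScalarTower K Γ X := IsScalarTower.of_algebraMap_smul fun _ _ => rfl
  have : IsScalarTower K Γ Y := IsScalarTower.of_algebraMap_smul fun _ _ => rfl
  have hf' : LinearMap.ker (f.restrictScalars K) = ⊥ := LinearMap.ker_eq_bot.2 hf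
  obtain ⟨l, hl⟩ := (f.restrictScalars K).exists_leftInverse_of_injective hf'
  have hl' : ∀ x, l (f x) = x := fun x => LinearMap.congr_fun hl x
  refine ⟨LinearMap.pi fun k => toRegularDual
    (((RegularDual.eval (1 : Γ)).comp (((LinearMap.proj k).comp g).restrictScalars K)).comp l),
    LinearMap.ext fun x => funext fun k => LinearMap.ext fun γ => ?_⟩
  refine Eq.trans ?_ (LinearMap.congr_fun (LinearMap.congr_fun
    (toRegularDual_eval_one ((LinearMap.proj k).comp g)) x) γ)
  change RegularDual.eval (1 : Γ) (g (l (γ • f x)) k) = RegularDual.eval (1 : Γ) (g (γ • x) k)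
  rw [← map_smul f, hl']

/-- Every finite-dimensional module embeds into a finite power of `DΓ`. -/
lemma exists_injective_regularDual (X : Type) [AddCommGroup X] [Module Γ X] [Module K X]
    [IsScalarTower K Γ X] [FiniteDimensional K X] :
    ∃ (n : ℕ) (u : X →ₗ[Γ] Fin n → RegularDual K Γ), Injective u := by
  let b := Module.finBasis K X
  refine ⟨_, LinearMap.pi fun k => toRegularDual (b.coord k), ?_⟩
  rw [← LinearMap.ker_eq_bot, LinearMap.ker_eq_bot']
  intro x hx
  refine b.ext_elem fun k => ?_
  have h := LinearMap.congr_fun (congrFun hx k) (1 : Γ)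
  change b.coord k ((1 : Γ) • x) = 0 at h
  rw [one_smul] at h
  simpa using h

/-- A finite-dimensional module `C` of injective dimension at most one has an injective
copresentation whose middle term is a finite power of `DΓ`, and whose last term is a
retract of a finite power of `DΓ`. -/
lemma exists_copresentation [FiniteDimensional K Γ] (C : Type) [AddCommGroup C] [Module Γ C]
    [Module K C] [IsScalarTower K Γ C] [FiniteDimensional K C]
    (hC : ∃ (I0 I1 : Type) (_ : AddCommGroup I0) (_ : Module Γ I0)
      (_ : AddCommGroup I1) (_ : Module Γ I1) (f : C →ₗ[Γ] I0) (g : I0 →ₗ[Γ] I1),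
      Module.Injective Γ I0 ∧ Module.Injective Γ I1 ∧ IsShortExact Γ f g) :
    ∃ (n : ℕ) (u : C →ₗ[Γ] Fin n → RegularDual K Γ), Injective u ∧ ∃ (m : ℕ)
      (i : ((Fin n → RegularDual K Γ) ⧸ LinearMap.range u) →ₗ[Γ] Fin m → RegularDual K Γ)
      (p : (Fin m → RegularDual K Γ) →ₗ[Γ] (Fin n → RegularDual K Γ) ⧸ LinearMap.range u),
      p.comp i = LinearMap.id := by
  obtain ⟨I₀, I₁, _, _, _, _, f, g, hI₀, hI₁, hf, hg, hex⟩ := hC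
  obtain ⟨n, u, hu⟩ := exists_injective_regularDual (K := K) (Γ := Γ) C
  set U := LinearMap.range u
  obtain ⟨m, i, hi⟩ := exists_injective_regularDual (K := K) (Γ := Γ)
    ((Fin n → RegularDual K Γ) ⧸ U)
  obtain ⟨a, ha⟩ := hI₀.out u hu f
  obtain ⟨b, hb⟩ := exists_extension_regularDual f hf u
  have hb' : ∀ c, b (f c) = u c := fun c => LinearMap.congr_fun hb c
  have hag : U ≤ LinearMap.ker (g.comp a) := by
    rintro _ ⟨c, rfl⟩
    change g (a (u c)) = 0
    rw [ha, hex.apply_apply_eq_zero]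
  have hbu : LinearMap.ker g ≤ LinearMap.ker (U.mkQ.comp b) := by
    intro x hx
    obtain ⟨c, rfl⟩ := (hex x).1 hx
    change U.mkQ (b (f c)) = 0
    rw [hb']
    exact (Submodule.Quotient.mk_eq_zero U).2 ⟨c, rfl⟩
  have hd : U ≤ LinearMap.ker (b.comp a - LinearMap.id) := by
    rintro _ ⟨c, rfl⟩
    change b (a (u c)) - u c = 0
    rw [ha, hb', sub_self]
  let a' := U.liftQ (g.comp a) hag
  let b' : I₁ →ₗ[Γ] _ := ((LinearMap.ker g).liftQ (U.mkQ.comp b) hbu).comp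
    (g.quotKerEquivOfSurjective hg).symm.toLinearMap
  have hb'g : ∀ x, b' (g x) = U.mkQ (b x) := by
    intro x
    have h1 : (g.quotKerEquivOfSurjective hg).symm (g x) = (LinearMap.ker g).mkQ x := by
      rw [LinearEquiv.symm_apply_eq]
      rfl
    change (LinearMap.ker g).liftQ _ hbu ((g.quotKerEquivOfSurjective hg).symm (g x)) = _
    rw [h1]
    rfl
  let d := U.liftQ (b.comp a - LinearMap.id) hd
  obtain ⟨a'', ha''⟩ := hI₁.out i hi a'
  obtain ⟨d', hd'⟩ := exists_extension_regularDual i hi d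
  refine ⟨n, u, hu, m, i, b'.comp a'' - U.mkQ.comp d', LinearMap.ext fun y => ?_⟩
  obtain ⟨x, rfl⟩ := U.mkQ_surjective y
  have h1 : d' (i (U.mkQ x)) = b (a x) - x := LinearMap.congr_fun hd' (U.mkQ x)
  change b' (a'' (i (U.mkQ x))) - U.mkQ (d' (i (U.mkQ x))) = U.mkQ x
  rw [ha'', h1]
  change b' (g (a x)) - _ = _
  rw [hb'g, map_sub, sub_sub_cancel]

end RegularDual

section Uniqueness

variable {A B : Type} [Ring A] [Ring B] {e : B}

/-- Intermediate extensions along a full corner are unique up to isomorphism. -/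
lemma nonempty_linearEquiv_of_isIntermediateExtension (φ : CornerMap A B e)
    (hφ : ∀ b : B, ∃ a : A, φ.toHom a = e * b * e)
    {M : Type} [AddCommGroup M] [Module A M]
    {Y Y' : Type} [AddCommGroup Y] [Module B Y] [AddCommGroup Y'] [Module B Y']
    (hY : IsIntermediateExtension φ M Y) (hY' : IsIntermediateExtension φ M Y') :
    Nonempty (Y ≃ₗ[B] Y') := by
  obtain ⟨hc, hs, ⟨θ₁⟩⟩ := hY
  obtain ⟨hc', hs', ⟨θ₂⟩⟩ := hY'
  let θ : ePart φ Y ≃ₗ[A] ePart φ Y' := θ₁.trans θ₂.symm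
  have he : e * e = e := by
    have h := φ.mem_left 1
    rwa [φ.map_one] at h
  let Z : Submodule B (Y × Y') := Submodule.span B (Set.range fun y => (y.val, (θ y).val))
  have hZ : ∀ z ∈ Z, ∀ b : B, ∃ y, e • b • z = (y.val, (θ y).val) := by
    intro z hz
    induction hz using Submodule.span_induction with
    | mem z h =>
      obtain ⟨y, rfl⟩ := h
      intro b
      obtain ⟨a, ha⟩ := hφ b
      refine ⟨a • y, ?_⟩
      rw [map_smul, ePart.smul_def, ePart.smul_def, ha]
      refine Prod.ext ?_ ?_
      · change e • b • y.val = (e * b * e) • y.val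
        rw [mul_smul, mul_smul, y.prop]
      · change e • b • (θ y).val = (e * b * e) • (θ y).val
        rw [mul_smul, mul_smul, (θ y).prop]
    | zero =>
      intro b
      refine ⟨0, ?_⟩
      rw [map_zero, smul_zero, smul_zero]
      rfl
    | add z z' _ _ h h' =>
      intro b
      obtain ⟨y, hy⟩ := h b
      obtain ⟨y', hy'⟩ := h' b
      refine ⟨y + y', ?_⟩
      rw [map_add, smul_add, smul_add, hy, hy']
      rfl
    | smul r z _ h =>
      intro b
      obtain ⟨y, hy⟩ := h (b * r)
      exact ⟨y, by rw [← hy, mul_smul]⟩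
  let p₁ : Z →ₗ[B] Y := (LinearMap.fst B Y Y').comp Z.subtype
  let p₂ : Z →ₗ[B] Y' := (LinearMap.snd B Y Y').comp Z.subtype
  have hp₁ : Bijective p₁ := by
    constructor
    · rw [← LinearMap.ker_eq_bot, LinearMap.ker_eq_bot']
      rintro ⟨z, hz⟩ (h0 : z.1 = 0)
      refine Subtype.ext (Prod.ext h0 (hs' _ fun b => ?_))
      obtain ⟨y, hy⟩ := hZ z hz b
      have h1 : y.val = 0 := by
        refine (congrArg Prod.fst hy).symm.trans ?_
        change e • b • z.1 = 0
        rw [h0, smul_zero, smul_zero]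
      have h2 : y = 0 := Subtype.ext h1
      change (e • b • z).2 = 0
      rw [hy, h2, map_zero]
      rfl
    · rw [← LinearMap.range_eq_top]
      refine top_le_iff.1 (hc.trans (Submodule.span_le.2 ?_))
      rintro _ ⟨w, rfl⟩
      let y : ePart φ Y := ⟨e • w, by rw [← mul_smul, he]⟩
      exact ⟨⟨(y.val, (θ y).val), Submodule.subset_span ⟨y, rfl⟩⟩, rfl⟩
  have hp₂ : Bijective p₂ := by
    constructor
    · rw [← LinearMap.ker_eq_bot, LinearMap.ker_eq_bot']
      rintro ⟨z, hz⟩ (h0 : z.2 = 0)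
      refine Subtype.ext (Prod.ext (hs _ fun b => ?_) h0)
      obtain ⟨y, hy⟩ := hZ z hz b
      have h1 : (θ y).val = 0 := by
        refine (congrArg Prod.snd hy).symm.trans ?_
        change e • b • z.2 = 0
        rw [h0, smul_zero, smul_zero]
      have h2 : y = 0 := θ.map_eq_zero_iff.1 (Subtype.ext h1)
      change (e • b • z).1 = 0
      rw [hy, h2]
      rfl
    · rw [← LinearMap.range_eq_top]
      refine top_le_iff.1 (hc'.trans (Submodule.span_le.2 ?_))
      rintro _ ⟨w, rfl⟩
      let y' : ePart φ Y' := ⟨e • w, by rw [← mul_smul, he]⟩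
      refine ⟨⟨_, Submodule.subset_span ⟨θ.symm y', rfl⟩⟩, ?_⟩
      change (θ (θ.symm y')).val = y'.val
      rw [θ.apply_symm_apply]
  exact ⟨(LinearEquiv.ofBijective p₁ hp₁).symm.trans (LinearEquiv.ofBijective p₂ hp₂)⟩

end Uniqueness

section Dual

variable {K A : Type} [Field K] [Ring A] [Algebra K A]
variable {E : Type} [AddCommGroup E] [Module A E] [Module K E] [IsScalarTower K A E]

instance ModuleDual.isScalarTower :
    IsScalarTower K (Module.End A E)ᵐᵒᵖ (ModuleDual K A E) where
  smul_assoc k γ f := LinearMap.ext fun x => by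
    change ModuleDual.toLin K A E f (k • γ.unop x) = k • ModuleDual.toLin K A E f (γ.unop x)
    rw [map_smul]

instance ModuleDual.finiteDimensional [FiniteDimensional K E] :
    FiniteDimensional K (ModuleDual K A E) :=
  inferInstanceAs (FiniteDimensional K (E →ₗ[K] K))

/-- Evaluation at an element of `E`, as a linear form on `DE`. -/
def ModuleDual.eval (x : E) : ModuleDual K A E →ₗ[K] K where
  toFun q := ModuleDual.toLin K A E q x
  map_add' _ _ := rfl
  map_smul' _ _ := rfl

lemma ModuleDual.exists_eval_eq [FiniteDimensional K E] (f : ModuleDual K A E →ₗ[K] K) :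
    ∃ x : E, ∀ q : ModuleDual K A E, f q = ModuleDual.toLin K A E q x := by
  obtain ⟨x, hx⟩ := (Module.evalEquiv K E).surjective (f : Module.Dual K (Module.Dual K E))
  exact ⟨x, fun q => (LinearMap.congr_fun hx q).symm⟩

lemma ModuleDual.ext_eval {x y : E}
    (h : ∀ q : ModuleDual K A E, ModuleDual.toLin K A E q x = ModuleDual.toLin K A E q y) :
    x = y :=
  sub_eq_zero.1 ((Module.forall_dual_apply_eq_zero_iff K (x - y)).1
    fun q => by rw [map_sub, sub_eq_zero]; exact h q)

lemma dualAct_apply (a : A) (q : ModuleDual K A E) (x : E) :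
    ModuleDual.toLin K A E (dualAct K A E a q) x = ModuleDual.toLin K A E q (a • x) := rfl

lemma toLin_op_smul (φ : Module.End A E) (q : ModuleDual K A E) (x : E) :
    ModuleDual.toLin K A E (MulOpposite.op φ • q) x = ModuleDual.toLin K A E q (φ x) := rfl

lemma dualAct_injective [FiniteDimensional K E] (hE : IsGenerator A E) :
    Injective (dualAct K A E) := by
  obtain ⟨n, i, p, hpi⟩ := hE
  intro a b hab
  have h1 : ∀ x : E, a • x = b • x := fun x => ModuleDual.ext_eval (K := K) (A := A) fun q => by
    rw [← dualAct_apply, hab, dualAct_apply]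
  have h2 : i a = i b := by
    rw [← mul_one a, ← mul_one b, ← smul_eq_mul, ← smul_eq_mul, map_smul, map_smul]
    exact funext fun k => h1 _
  rw [← LinearMap.id_apply (R := A) a, ← LinearMap.id_apply (R := A) b, ← hpi]
  exact congrArg p h2

/-- A generator is balanced: every endomorphism of `DE` over `End_A(E)ᵒᵖ` is given by the
action of an element of `A`. -/
lemma dualAct_surjective [FiniteDimensional K E] (hE : IsGenerator A E)
    (ψ : ModuleDual K A E →ₗ[(Module.End A E)ᵐᵒᵖ] ModuleDual K A E) :
    ∃ a : A, dualAct K A E a = ψ := by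
  obtain ⟨n, i, p, hpi⟩ := hE
  choose t ht using fun x : E => ModuleDual.exists_eval_eq (A := A)
    ((ModuleDual.eval x).comp (ψ.restrictScalars K))
  have ht' : ∀ (x : E) (q : ModuleDual K A E),
      ModuleDual.toLin K A E (ψ q) x = ModuleDual.toLin K A E q (t x) := ht
  have hadd : ∀ x y, t (x + y) = t x + t y := fun x y =>
    ModuleDual.ext_eval (K := K) (A := A) fun q => by
      rw [← ht', map_add, map_add, ht', ht']
  have hcomm : ∀ (φ : Module.End A E) (x : E), t (φ x) = φ (t x) := fun φ x =>
    ModuleDual.ext_eval (K := K) (A := A) fun q => by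
      rw [← ht', ← toLin_op_smul, ← map_smul, ht', toLin_op_smul]
  let t' : E →+ E := AddMonoidHom.mk' t hadd
  refine ⟨p fun k => t (i 1 k), LinearMap.ext fun q => LinearMap.ext fun x => ?_⟩
  change ModuleDual.toLin K A E q ((p fun k => t (i 1 k)) • x) = ModuleDual.toLin K A E (ψ q) x
  rw [ht']
  congr 1
  let φ : Fin n → Module.End A E := fun k =>
    (LinearMap.toSpanSingleton A E x).comp (p.comp (LinearMap.single A (fun _ => E) k))
  have hφ : ∀ v : Fin n → E, p v • x = ∑ k, φ k (v k) := by
    intro v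
    change LinearMap.toSpanSingleton A E x (p v) =
      ∑ k, LinearMap.toSpanSingleton A E x (p (Pi.single k (v k)))
    rw [← map_sum, ← map_sum, Finset.univ_sum_single]
  have hx : x = ∑ k, φ k (i 1 k) := by
    rw [← hφ, show p (i 1) = 1 from LinearMap.congr_fun hpi 1, one_smul]
  rw [hφ]
  conv_rhs => rw [hx]
  change _ = t' _
  rw [map_sum]
  exact Finset.sum_congr rfl fun k _ => (hcomm (φ k) (i 1 k)).symm

end Dual

section Cotilting

variable {K A : Type} [Field K] [Ring A] [Algebra K A]
variable {E : Type} [AddCommGroup E] [Module A E] [Module K E] [IsScalarTower K A E]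
variable {C : Type} [AddCommGroup C] [Module (Module.End A E)ᵐᵒᵖ C]
  [Module K C] [IsScalarTower K (Module.End A E)ᵐᵒᵖ C]

/-- A `Q`-special cotilting module is cogenerated by `Q`. -/
lemma IsSpecialCotilting.eq_zero_of_forall_apply_eq_zero {Γ : Type} [Ring Γ] [Algebra K Γ]
    {Q : Type} [AddCommGroup Q] [Module Γ Q] {C : Type} [AddCommGroup C] [Module Γ C]
    [Module K C] [IsScalarTower K Γ C] (hC : IsSpecialCotilting Γ K Q C) (c : C)
    (hc : ∀ h : C →ₗ[Γ] Q, h c = 0) : c = 0 := by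
  obtain ⟨C₁, C₀, _, _, _, _, f, g, ⟨n, i, p, hpi⟩, hC₁, hfg⟩ := hC.resolves_special
  refine (Module.forall_dual_apply_eq_zero_iff K c).1 fun q => ?_
  obtain ⟨v, hv⟩ := exists_lift_of_rigid hC.isCotilting.rigid hC₁ f g hfg (toRegularDual q)
  have h1 : i (v c) = 0 := funext fun k => hc ((LinearMap.proj k).comp (i.comp v))
  have h2 : v c = 0 := by
    rw [← LinearMap.id_apply (R := Γ) (v c), ← hpi, LinearMap.comp_apply, h1, map_zero]
  have h3 : toRegularDual q c = (0 : RegularDual K Γ) := by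
    rw [← hv, LinearMap.comp_apply, h2, map_zero]
  have h4 := LinearMap.congr_fun h3 (1 : Γ)
  change q ((1 : Γ) • c) = 0 at h4
  rwa [one_smul] at h4

/-- The map `DE → D End_A(E)ᵒᵖ` given by an element of `E`. -/
def evalHom (K : Type) [Field K] [Algebra K A] [Module K E] [IsScalarTower K A E] (x : E) :
    ModuleDual K A E →ₗ[(Module.End A E)ᵐᵒᵖ] RegularDual K (Module.End A E)ᵐᵒᵖ :=
  toRegularDual (ModuleDual.eval x)

lemma evalHom_apply (x : E) (q : ModuleDual K A E) (γ : (Module.End A E)ᵐᵒᵖ) :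
    RegularDual.toLin K _ (evalHom K x q) γ = ModuleDual.toLin K A E q (γ.unop x) := rfl

lemma exists_evalHom_eq [FiniteDimensional K E]
    (u : ModuleDual K A E →ₗ[(Module.End A E)ᵐᵒᵖ] RegularDual K (Module.End A E)ᵐᵒᵖ) :
    ∃ x : E, evalHom K x = u := by
  obtain ⟨x, hx⟩ := ModuleDual.exists_eval_eq (A := A)
    ((RegularDual.eval (1 : (Module.End A E)ᵐᵒᵖ)).comp (u.restrictScalars K))
  refine ⟨x, ?_⟩
  rw [← toRegularDual_eval_one u]
  exact congrArg toRegularDual (LinearMap.ext fun q => (hx q).symm)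

lemma evalHom_add (x y : E) : evalHom (A := A) K (x + y) = evalHom K x + evalHom K y :=
  LinearMap.ext fun q => LinearMap.ext fun γ => by
    change ModuleDual.toLin K A E q (γ.unop (x + y)) =
      ModuleDual.toLin K A E q (γ.unop x) + ModuleDual.toLin K A E q (γ.unop y)
    rw [map_add, map_add]

lemma evalHom_smul (a : A) (x : E) :
    evalHom (A := A) K (a • x) = (evalHom K x).comp (dualAct K A E a) :=
  LinearMap.ext fun q => LinearMap.ext fun γ => by
    change ModuleDual.toLin K A E q (γ.unop (a • x)) = ModuleDual.toLin K A E q (a • γ.unop x)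
    rw [map_smul]

instance finiteDimensional_end [FiniteDimensional K E] :
    FiniteDimensional K (Module.End A E) :=
  Module.Finite.of_injective (LinearMap.restrictScalarsₗ K A E E K)
    (LinearMap.restrictScalars_injective K)

/-- The module `D End_A(E)ᵒᵖ` is generated by `DE`. -/
lemma eq_of_forall_evalHom [FiniteDimensional K E] {ι : Type} [Fintype ι] [DecidableEq ι]
    {v w : (ι → RegularDual K (Module.End A E)ᵐᵒᵖ) →ₗ[K] K}
    (h : ∀ (u : ModuleDual K A E →ₗ[(Module.End A E)ᵐᵒᵖ]
      ι → RegularDual K (Module.End A E)ᵐᵒᵖ) (q : ModuleDual K A E), v (u q) = w (u q)) :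
    v = w := by
  refine LinearMap.pi_ext' fun k => ?_
  rw [← sub_eq_zero]
  set d := v.comp (LinearMap.single K _ k) - w.comp (LinearMap.single K _ k)
  obtain ⟨γ, hγ⟩ := (Module.evalEquiv K (Module.End A E)ᵐᵒᵖ).surjective
    (d : Module.Dual K (Module.Dual K (Module.End A E)ᵐᵒᵖ))
  have hγ' : ∀ f : RegularDual K (Module.End A E)ᵐᵒᵖ, d f = RegularDual.toLin K _ f γ :=
    fun f => (LinearMap.congr_fun hγ f).symm
  have h0 : γ = 0 := by
    refine MulOpposite.unop_injective (LinearMap.ext fun x => ?_)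
    refine ModuleDual.ext_eval (K := K) (A := A) fun q => ?_
    rw [← evalHom_apply, ← hγ']
    have h1 := h ((LinearMap.single _ _ k).comp (evalHom K x)) q
    rw [MulOpposite.unop_zero, LinearMap.zero_apply, map_zero]
    exact sub_eq_zero.2 h1
  exact LinearMap.ext fun f => by rw [hγ', h0, map_zero, LinearMap.zero_apply]

/-- A linear form on `C` which vanishes on the image of every map `DE → C` is zero, if `C` has
injective dimension at most one, no self-extensions and `DE` as a direct summand. -/
lemma eq_zero_of_forall_comp_eq_zero [FiniteDimensional K E] [FiniteDimensional K C]
    (hC : IsCotilting (Module.End A E)ᵐᵒᵖ K C)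
    (i₀ : ModuleDual K A E →ₗ[(Module.End A E)ᵐᵒᵖ] C)
    (p₀ : C →ₗ[(Module.End A E)ᵐᵒᵖ] ModuleDual K A E) (hsplit : p₀.comp i₀ = LinearMap.id)
    (f : C →ₗ[K] K)
    (hf : ∀ (h : ModuleDual K A E →ₗ[(Module.End A E)ᵐᵒᵖ] C) (q : ModuleDual K A E),
      f (h q) = 0) : f = 0 := by
  obtain ⟨n, u, hu, hex⟩ := exists_copresentation (K := K) C hC.idim_le_one
  set U := LinearMap.range u
  obtain ⟨m, i, p, hpi⟩ := hex
  have hlift : ∀ g : ModuleDual K A E →ₗ[(Module.End A E)ᵐᵒᵖ] _ ⧸ U,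
      ∃ h : ModuleDual K A E →ₗ[(Module.End A E)ᵐᵒᵖ] _, U.mkQ.comp h = g := by
    intro g
    obtain ⟨v, hv⟩ := exists_lift_of_rigid hC.rigid
      (⟨1, LinearMap.pi fun _ => LinearMap.id, LinearMap.proj 0, rfl⟩ : InAdd _ C C) u U.mkQ
      ⟨hu, U.mkQ_surjective, fun x => by
        rw [← LinearMap.mem_ker, U.ker_mkQ]
        rfl⟩ (g.comp p₀)
    refine ⟨v.comp i₀, ?_⟩
    rw [← LinearMap.comp_assoc, hv, LinearMap.comp_assoc, hsplit, LinearMap.comp_id]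
  obtain ⟨l, hl⟩ := (u.restrictScalars K).exists_leftInverse_of_injective
    (LinearMap.ker_eq_bot.2 hu)
  have hl' : ∀ c, l (u c) = c := fun c => LinearMap.congr_fun hl c
  let f' := f.comp l
  have hf' : ∀ c, f' (u c) = f c := fun c => congrArg f (hl' c)
  have hzero : ∀ h : ModuleDual K A E →ₗ[(Module.End A E)ᵐᵒᵖ] _,
      U.mkQ.comp h = 0 → ∀ q, f' (h q) = 0 := by
    intro h hh q
    have hmem : ∀ q, h q ∈ U := fun q =>
      (Submodule.Quotient.mk_eq_zero U).1 (LinearMap.congr_fun hh q)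
    let h' := (LinearEquiv.ofInjective u hu).symm.toLinearMap.comp (h.codRestrict U hmem)
    have hh' : u (h' q) = h q :=
      congrArg Subtype.val ((LinearEquiv.ofInjective u hu).apply_symm_apply ⟨h q, hmem q⟩)
    rw [← hh', hf', hf]
  have hex : ∀ g : ModuleDual K A E →ₗ[(Module.End A E)ᵐᵒᵖ] _ ⧸ U, ∃ y : E,
      ∀ h : ModuleDual K A E →ₗ[(Module.End A E)ᵐᵒᵖ] _, U.mkQ.comp h = g → ∀ q, f' (h q) = ModuleDual.toLin K A E q y := by
    intro g
    obtain ⟨h₀, hh₀⟩ := hlift g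
    obtain ⟨y, hy⟩ := ModuleDual.exists_eval_eq (A := A) (f'.comp (h₀.restrictScalars K))
    refine ⟨y, fun h hh q => ?_⟩
    rw [← hy, ← sub_eq_zero]
    have h1 := hzero (h - h₀) (by rw [LinearMap.comp_sub, hh, hh₀, sub_self]) q
    rwa [LinearMap.sub_apply, map_sub] at h1
  choose y hy using hex
  have hy_add : ∀ g g', y (g + g') = y g + y g' := by
    intro g g'
    obtain ⟨h, hh⟩ := hlift g
    obtain ⟨h', hh'⟩ := hlift g'
    refine ModuleDual.ext_eval (K := K) (A := A) fun q => ?_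
    rw [← hy _ (h + h') (by rw [LinearMap.comp_add, hh, hh']), map_add, ← hy _ h hh,
      ← hy _ h' hh', LinearMap.add_apply, map_add]
  have hy_act : ∀ g (a : A), y (g.comp (dualAct K A E a)) = a • y g := by
    intro g a
    obtain ⟨h, hh⟩ := hlift g
    refine ModuleDual.ext_eval (K := K) (A := A) fun q => ?_
    rw [← hy _ (h.comp (dualAct K A E a)) (by rw [← LinearMap.comp_assoc, hh]),
      ← dualAct_apply, ← hy _ h hh]
    rfl
  let y' : _ →+ E := AddMonoidHom.mk' y hy_add
  let s : Fin m → E → (ModuleDual K A E →ₗ[(Module.End A E)ᵐᵒᵖ] _ ⧸ U) := fun k x =>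
    p.comp ((LinearMap.single _ _ k).comp (evalHom K x))
  let α : Fin m → Module.End A E := fun k =>
    { toFun := fun x => y (s k x)
      map_add' := fun x x' => by
        rw [← hy_add]
        change y (p.comp ((LinearMap.single _ _ k).comp (evalHom K (x + x')))) = _
        rw [evalHom_add, LinearMap.comp_add, LinearMap.comp_add]
      map_smul' := fun a x => by
        rw [RingHom.id_apply, ← hy_act]
        change y (p.comp ((LinearMap.single _ _ k).comp (evalHom K (a • x)))) = _
        rw [evalHom_smul]
        rfl }
  let f₁ : (Fin m → RegularDual K (Module.End A E)ᵐᵒᵖ) →ₗ[K] K :=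
    ∑ k, (RegularDual.eval (MulOpposite.op (α k))).comp (LinearMap.proj k)
  have hf₁ : f' = f₁.comp ((i.comp U.mkQ).restrictScalars K) := by
    refine eq_of_forall_evalHom fun h q => ?_
    choose x hx using fun k => exists_evalHom_eq
      ((LinearMap.proj k).comp (i.comp (U.mkQ.comp h)))
    have h1 : U.mkQ.comp h = ∑ k, s k (x k) := by
      have h2 : i.comp (U.mkQ.comp h) = ∑ k, (LinearMap.single _ _ k).comp (evalHom K (x k)) := by
        refine LinearMap.ext fun q => ?_
        rw [LinearMap.sum_apply]
        simp only [hx]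
        exact (Finset.univ_sum_single (i (U.mkQ (h q)))).symm
      calc U.mkQ.comp h = p.comp (i.comp (U.mkQ.comp h)) := by
            rw [← LinearMap.comp_assoc, hpi, LinearMap.id_comp]
        _ = _ := by
            rw [h2]
            exact LinearMap.ext fun q => by simp [s, LinearMap.sum_apply]
    have h3 : y (U.mkQ.comp h) = ∑ k, α k (x k) := by
      change y' _ = _
      rw [h1, map_sum]
      rfl
    rw [hy _ h rfl q, h3, map_sum]
    change _ = (∑ k, (RegularDual.eval (MulOpposite.op (α k))).comp (LinearMap.proj k))
      (i (U.mkQ (h q)))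
    rw [LinearMap.sum_apply]
    refine Finset.sum_congr rfl fun k _ => ?_
    have h4 := LinearMap.congr_fun (hx k) q
    change _ = RegularDual.toLin K _ (i (U.mkQ (h q)) k) (MulOpposite.op (α k))
    change evalHom K (x k) q = i (U.mkQ (h q)) k at h4
    rw [← h4, evalHom_apply, MulOpposite.unop_op]
  refine LinearMap.ext fun c => ?_
  rw [← hf', hf₁]
  change f₁ (i (U.mkQ (u c))) = 0
  have hc : U.mkQ (u c) = 0 := (Submodule.Quotient.mk_eq_zero U).2 ⟨c, rfl⟩
  rw [hc, map_zero, map_zero]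

end Cotilting

section GeneratorCotilted

variable {K A : Type} [Field K] [Ring A] [Algebra K A]
variable {E : Type} [AddCommGroup E] [Module A E] [Module K E] [IsScalarTower K A E]
  [FiniteDimensional K E]
variable {C : Type} [AddCommGroup C] [Module (Module.End A E)ᵐᵒᵖ C]
variable {i₀ : ModuleDual K A E →ₗ[(Module.End A E)ᵐᵒᵖ] C}
  {p₀ : C →ₗ[(Module.End A E)ᵐᵒᵖ] ModuleDual K A E}

/-- The canonical corner map is onto the corner at the special idempotent. -/
lemma canonicalCornerMap_surjective (hE : IsGenerator A E) (hsplit : p₀.comp i₀ = LinearMap.id)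
    (b : (Module.End (Module.End A E)ᵐᵒᵖ C)ᵐᵒᵖ) :
    ∃ a : A, (canonicalCornerMap K A E C i₀ p₀ hsplit).toHom a =
      MulOpposite.op (i₀.comp p₀) * b * MulOpposite.op (i₀.comp p₀) := by
  obtain ⟨a, ha⟩ := dualAct_surjective hE (p₀.comp (b.unop.comp i₀))
  refine ⟨a, MulOpposite.unop_injective ?_⟩
  change (i₀.comp (dualAct K A E a)).comp p₀ = _
  rw [ha]
  rfl

variable [Module K C] [IsScalarTower K (Module.End A E)ᵐᵒᵖ C] [FiniteDimensional K C]

/-- The dual of the special cotilting module is the intermediate extension of `E`. -/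
lemma isIntermediateExtension_moduleDual
    (hC : IsSpecialCotilting (Module.End A E)ᵐᵒᵖ K (ModuleDual K A E) C)
    (hsplit : p₀.comp i₀ = LinearMap.id) :
    IsIntermediateExtension (canonicalCornerMap K A E C i₀ p₀ hsplit) E
      (ModuleDual K (Module.End A E)ᵐᵒᵖ C) := by
  have hpi : ∀ q, p₀ (i₀ q) = q := fun q => LinearMap.congr_fun hsplit q
  refine ⟨?_, ?_, ?_⟩
  · let S : Set (Module.Dual K C) := {z | ∃ (w : C →ₗ[K] K)
      (b : Module.End (Module.End A E)ᵐᵒᵖ C),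
      z = w.comp ((i₀.comp (p₀.comp b)).restrictScalars K)}
    have hS : Submodule.span K S = ⊤ := by
      have h0 : (Submodule.span K S).dualCoannihilator = ⊥ := by
        rw [Submodule.eq_bot_iff]
        intro c hc
        refine hC.eq_zero_of_forall_apply_eq_zero c fun h => ?_
        have h1 : i₀ (h c) = 0 := (Module.forall_dual_apply_eq_zero_iff K _).1 fun w => by
          have h2 := (Submodule.mem_dualCoannihilator _).1 hc _
            (Submodule.subset_span ⟨w, i₀.comp h, rfl⟩)
          change w (i₀ (p₀ (i₀ (h c)))) = 0 at h2
          rwa [hpi] at h2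
        rw [← hpi (h c), h1, map_zero]
      rw [← Subspace.dualCoannihilator_dualAnnihilator_eq
        (W := Submodule.span K S), h0, Submodule.dualAnnihilator_bot]
    rintro f -
    have hf : ModuleDual.toLin K _ C f ∈ Submodule.span K S :=
      hS ▸ Submodule.mem_top
    change Module.Dual K C at f
    change f ∈ _ at hf
    change (show ModuleDual K (Module.End A E)ᵐᵒᵖ C from f) ∈ _
    induction hf using Submodule.span_induction with
    | mem z hz =>
      obtain ⟨w, b, rfl⟩ := hz
      let w' : ModuleDual K (Module.End A E)ᵐᵒᵖ C := w
      have hw : MulOpposite.op (i₀.comp p₀) • w' ∈ {z : ModuleDual K (Module.End A E)ᵐᵒᵖ C |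
          ∃ w, z = MulOpposite.op (i₀.comp p₀) • w} := ⟨w', rfl⟩
      exact Submodule.smul_mem _ (MulOpposite.op b) (Submodule.subset_span hw)
    | zero => exact Submodule.zero_mem _
    | add z z' _ _ h h' => exact Submodule.add_mem _ h h'
    | smul k z _ h =>
      have h1 : (MulOpposite.op (algebraMap K (Module.End (Module.End A E)ᵐᵒᵖ C) k) •
          (show ModuleDual K (Module.End A E)ᵐᵒᵖ C from z)) = k • z :=
        LinearMap.ext fun c => map_smul z k c
      rw [← h1]
      exact Submodule.smul_mem _ _ h
  · intro f hf
    refine eq_zero_of_forall_comp_eq_zero hC.isCotilting i₀ p₀ hsplit f fun h q => ?_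
    have h1 := LinearMap.congr_fun (hf (MulOpposite.op (h.comp p₀))) (i₀ q)
    change ModuleDual.toLin K _ C f (h (p₀ (i₀ (p₀ (i₀ q))))) = 0 at h1
    rwa [hpi, hpi] at h1
  · let θ : E →ₗ[A] ePart (canonicalCornerMap K A E C i₀ p₀ hsplit)
        (ModuleDual K (Module.End A E)ᵐᵒᵖ C) :=
      { toFun := fun x => ⟨(ModuleDual.eval x).comp (p₀.restrictScalars K), by
          refine LinearMap.ext fun c => ?_
          change ModuleDual.toLin K A E (p₀ (i₀ (p₀ c))) x = ModuleDual.toLin K A E (p₀ c) x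
          rw [hpi]⟩
        map_add' := fun x y => Subtype.ext (LinearMap.ext fun c =>
          map_add (ModuleDual.toLin K A E (p₀ c)) x y)
        map_smul' := fun a x => Subtype.ext (LinearMap.ext fun c => by
          change ModuleDual.toLin K A E (p₀ c) (a • x) =
            ModuleDual.toLin K A E (p₀ (i₀ (dualAct K A E a (p₀ c)))) x
          rw [hpi, dualAct_apply]) }
    refine ⟨(LinearEquiv.ofBijective θ ⟨fun x y hxy => ?_, fun f => ?_⟩).symm⟩
    · refine ModuleDual.ext_eval (K := K) (A := A) fun q => ?_
      have h1 := LinearMap.congr_fun (congrArg Subtype.val hxy) (i₀ q)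
      change ModuleDual.toLin K A E (p₀ (i₀ q)) x = ModuleDual.toLin K A E (p₀ (i₀ q)) y at h1
      rwa [hpi] at h1
    · obtain ⟨x, hx⟩ := ModuleDual.exists_eval_eq (A := A)
        ((ModuleDual.toLin K _ C f.val).comp (i₀.restrictScalars K))
      refine ⟨x, Subtype.ext (LinearMap.ext fun c => ?_)⟩
      refine (hx (p₀ c)).symm.trans ?_
      exact LinearMap.congr_fun f.prop c

/-- The left ideal at the special idempotent is the intermediate extension of `A`. -/
lemma isIntermediateExtension_leftCornerIdeal (hE : IsGenerator A E)
    (hC : IsSpecialCotilting (Module.End A E)ᵐᵒᵖ K (ModuleDual K A E) C)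
    (hsplit : p₀.comp i₀ = LinearMap.id) :
    IsIntermediateExtension (canonicalCornerMap K A E C i₀ p₀ hsplit) A
      (leftCornerIdeal (Module.End (Module.End A E)ᵐᵒᵖ C)ᵐᵒᵖ
        (MulOpposite.op (i₀.comp p₀))) := by
  let φ := canonicalCornerMap K A E C i₀ p₀ hsplit
  let e : (Module.End (Module.End A E)ᵐᵒᵖ C)ᵐᵒᵖ := MulOpposite.op (i₀.comp p₀)
  have hpi : ∀ q, p₀ (i₀ q) = q := fun q => LinearMap.congr_fun hsplit q
  have he : e * e = e := by
    have h := φ.mem_left 1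
    rwa [φ.map_one] at h
  refine ⟨?_, ?_, ?_⟩
  · rintro ⟨b, hb⟩ -
    have h1 : (⟨b, hb⟩ : leftCornerIdeal _ e) = b • (⟨e, he⟩ : leftCornerIdeal _ e) :=
      Subtype.ext (Eq.symm hb)
    rw [h1]
    exact Submodule.smul_mem _ _ (Submodule.subset_span ⟨⟨e, he⟩, Subtype.ext he.symm⟩)
  · rintro ⟨b, hb⟩ h
    have hb' : b * e = b := hb
    refine Subtype.ext (MulOpposite.unop_injective ?_)
    refine LinearMap.ext fun c => ?_
    refine (Module.forall_dual_apply_eq_zero_iff K _).1 fun w => ?_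
    change (w.comp (b.unop.restrictScalars K)) c = 0
    rw [eq_zero_of_forall_comp_eq_zero hC.isCotilting i₀ p₀ hsplit
      (w.comp (b.unop.restrictScalars K)) fun g q => ?_, LinearMap.zero_apply]
    have h1 := congrArg Subtype.val (h (MulOpposite.op (g.comp p₀)))
    have h2 := LinearMap.congr_fun (congrArg MulOpposite.unop h1) (i₀ q)
    change b.unop (g (p₀ (i₀ (p₀ (i₀ q))))) = 0 at h2
    rw [hpi, hpi] at h2
    change w (b.unop (g q)) = 0
    rw [h2, map_zero]
  · let θ : A →ₗ[A] ePart φ (leftCornerIdeal _ e) :=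
      { toFun := fun a => ⟨⟨φ.toHom a, φ.mem_right a⟩, Subtype.ext (φ.mem_left a)⟩
        map_add' := fun a b => Subtype.ext (Subtype.ext (map_add φ.toHom a b))
        map_smul' := fun a b => Subtype.ext (Subtype.ext (φ.map_mul a b)) }
    refine ⟨(LinearEquiv.ofBijective θ ⟨fun a b hab => ?_, fun y => ?_⟩).symm⟩
    · refine dualAct_injective (K := K) hE (LinearMap.ext fun q => ?_)
      have h1 : φ.toHom a = φ.toHom b := congrArg (fun z => z.val.val) hab
      have h2 := congrArg p₀ (LinearMap.congr_fun (congrArg MulOpposite.unop h1) (i₀ q))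
      change p₀ (i₀ (dualAct K A E a (p₀ (i₀ q)))) = p₀ (i₀ (dualAct K A E b (p₀ (i₀ q)))) at h2
      rwa [hpi, hpi, hpi] at h2
    · obtain ⟨a, ha⟩ := canonicalCornerMap_surjective hE hsplit y.val.val
      refine ⟨a, Subtype.ext (Subtype.ext (ha.trans ?_))⟩
      have h1 : e * y.val.val = y.val.val := congrArg Subtype.val y.prop
      have h2 : y.val.val * e = y.val.val := y.val.property
      change e * y.val.val * e = y.val.val
      rw [h1, h2]

end GeneratorCotilted

/-- The left ideal at an idempotent is projective. -/
lemma projective_leftCornerIdeal {B : Type} [Ring B] {e : B} (he : e * e = e) :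
    Module.Projective B (leftCornerIdeal B e) :=
  Module.Projective.of_split (leftCornerIdeal B e).subtype
    ((LinearMap.toSpanSingleton B B e).codRestrict (leftCornerIdeal B e) fun b => by
      change b * e * e = b * e
      rw [mul_assoc, he])
    (LinearMap.ext fun b => Subtype.ext b.property)

/-- Let `A` be a finite-dimensional `K`-algebra, `E` a basic
finite-dimensional generating `A`-module, `Γ = End_A(E)ᵒᵖ`, `Q = D E`, and let
`B = End_Γ(C^Q)ᵒᵖ` be the generator-cotilted algebra of `E` (where `C^Q` is the unique
basic `Q`-special cotilting `Γ`-module), with special idempotent `e` given by projection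
onto the summand `Q` of `C^Q`, and `c : mod A → mod B` the corresponding intermediate
extension functor (characterised on objects by `IsIntermediateExtension`).  Then
`c(E) ≅ D C^Q` and `c(A) ≅ Be`; in particular `c(A)` is a projective `B`-module. -/
theorem intermediate_extension_of_generator_cotilted_algebra
    (K A : Type) [Field K] [Ring A] [Algebra K A] [FiniteDimensional K A]
    (E : Type) [AddCommGroup E] [Module A E] [Module K E] [IsScalarTower K A E]
    [FiniteDimensional K E]
    (hEbasic : IsBasic A E) (hEgen : IsGenerator A E)
    -- `C` is the basic `Q`-special cotilting module over `Γ = End_A(E)ᵒᵖ`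
    (C : Type) [AddCommGroup C] [Module (Module.End A E)ᵐᵒᵖ C]
    [Module K C] [IsScalarTower K (Module.End A E)ᵐᵒᵖ C] [FiniteDimensional K C]
    (hC : IsSpecialCotilting (Module.End A E)ᵐᵒᵖ K (ModuleDual K A E) C)
    (hCbasic : IsBasic (Module.End A E)ᵐᵒᵖ C)
    -- the summand data exhibiting `Q = D E` as a direct summand of `C`, giving the
    -- special idempotent `e = op (i₀ ∘ p₀)` of `B = End_Γ(C)ᵒᵖ`
    (i₀ : ModuleDual K A E →ₗ[(Module.End A E)ᵐᵒᵖ] C)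
    (p₀ : C →ₗ[(Module.End A E)ᵐᵒᵖ] ModuleDual K A E)
    (hsplit : p₀.comp i₀ = LinearMap.id) :
    -- `c(E) ≅ D C^Q`
    (∀ (Y : Type) (_ : AddCommGroup Y)
        (_ : Module (Module.End (Module.End A E)ᵐᵒᵖ C)ᵐᵒᵖ Y),
      IsIntermediateExtension (canonicalCornerMap K A E C i₀ p₀ hsplit) E Y →
        Nonempty (Y ≃ₗ[(Module.End (Module.End A E)ᵐᵒᵖ C)ᵐᵒᵖ]
          ModuleDual K (Module.End A E)ᵐᵒᵖ C)) ∧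
    -- `c(A) ≅ Be`, and it is projective
    (∀ (Y : Type) (_ : AddCommGroup Y)
        (_ : Module (Module.End (Module.End A E)ᵐᵒᵖ C)ᵐᵒᵖ Y),
      IsIntermediateExtension (canonicalCornerMap K A E C i₀ p₀ hsplit) A Y →
        Nonempty (Y ≃ₗ[(Module.End (Module.End A E)ᵐᵒᵖ C)ᵐᵒᵖ]
            leftCornerIdeal (Module.End (Module.End A E)ᵐᵒᵖ C)ᵐᵒᵖ
              (MulOpposite.op (i₀.comp p₀))) ∧
          Module.Projective (Module.End (Module.End A E)ᵐᵒᵖ C)ᵐᵒᵖ Y) := by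
  have hφ := canonicalCornerMap_surjective (K := K) hEgen hsplit
  refine ⟨fun Y _ _ hY => nonempty_linearEquiv_of_isIntermediateExtension _ hφ hY
    (isIntermediateExtension_moduleDual hC hsplit), fun Y _ _ hY => ?_⟩
  obtain ⟨θ⟩ := nonempty_linearEquiv_of_isIntermediateExtension _ hφ hY
    (isIntermediateExtension_leftCornerIdeal hEgen hC hsplit)
  have he := (canonicalCornerMap K A E C i₀ p₀ hsplit).mem_left 1
  rw [(canonicalCornerMap K A E C i₀ p₀ hsplit).map_one] at he
  have := projective_leftCornerIdeal he
  exact ⟨⟨θ⟩, Module.Projective.of_equiv θ.symm⟩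

end GenFinitePaper
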